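/- Fix a layered episodic MDP with transition function P and a policy π, generate a random trajectory under π, and let c be a real random variable on the same probability space with 0 ≤ c ≤ 1 almost surely. Fix s ∈ S ∖ {s_L} and a ∈ A with π(a|s) > 0, let u_s be a real number with u_s ≥ q(s) and u_s > 0, set u(s,a) = u_s·π(a|s), and assume u(s,a) ≤ 1. Then the estimator ℓ^u(s,a) = (c·𝕀(s,a) + (1 − π(a|s) − c)·𝕀(s)·π(a|s)) / u(s,a) − (1 − π(a|s)) satisfies E[ (ℓ^u(s,a))² ] ≤ 8·( (1 − π(a|s)) / u(s,a) )·( q(s)/u_s + 1 ). -/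

import Mathlib

open MeasureTheory Finset

/-- A layered episodic MDP: finite state set `S` partitioned into layers `0, …, L` by `layer`,
with unique initial state `s0` (layer `0`), unique terminal state `sL` (layer `L`),
nonempty layers, and a transition function `P` supported on consecutive layers with rows
summing to `1` on non-terminal layers. -/
structure LayeredMDP (S A : Type) [Fintype S] [Fintype A] where
  L : ℕ
  layer : S → ℕ
  s0 : S
  sL : S
  P : S → A → S → ℝ
  layer_le : ∀ s, layer s ≤ L
  layer_s0 : layer s0 = 0
  layer_sL : layer sL = L
  s0_unique : ∀ s, layer s = 0 → s = s0
  sL_unique : ∀ s, layer s = L → s = sL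
  layer_nonempty : ∀ k, k ≤ L → ∃ s, layer s = k
  P_nonneg : ∀ s a s', 0 ≤ P s a s'
  P_layer : ∀ s a s', P s a s' ≠ 0 → layer s' = layer s + 1
  P_sum : ∀ s a, layer s < L → ∑ s', P s a s' = 1

variable {S A : Type} [Fintype S] [Fintype A] [DecidableEq S] [DecidableEq A]

/-- `pol` is a policy: nonnegative, and rows sum to `1` at every non-terminal state. -/
def IsPolicy (M : LayeredMDP S A) (pol : S → A → ℝ) : Prop :=
  (∀ s a, 0 ≤ pol s a) ∧ ∀ s, s ≠ M.sL → ∑ a, pol s a = 1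

/-- State-action value function computed with `n` remaining layers of fuel. -/
noncomputable def Qfuel (M : LayeredMDP S A) (pol l : S → A → ℝ) :
    ℕ → S → A → ℝ
  | 0, _, _ => 0
  | n + 1, s, a => l s a + ∑ s', M.P s a s' * ∑ a', pol s' a' * Qfuel M pol l n s' a'

/-- The state-action value function `Q^{P,π}(s,a; ℓ)`. -/
noncomputable def Qval (M : LayeredMDP S A) (pol l : S → A → ℝ) (s : S) (a : A) : ℝ :=
  if M.layer s = M.L then 0 else Qfuel M pol l (M.L - M.layer s) s a

/-- The state value function `V^{P,π}(s; ℓ) = ∑_a π(a|s) Q^{P,π}(s,a; ℓ)`. -/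
noncomputable def Vval (M : LayeredMDP S A) (pol l : S → A → ℝ) (s : S) : ℝ :=
  ∑ a, pol s a * Qval M pol l s a

/-- A trajectory `(s_0, a_0, …, s_{L-1}, a_{L-1}, s_L)`. -/
abbrev Traj (M : LayeredMDP S A) : Type := (Fin (M.L + 1) → S) × (Fin M.L → A)

/-- Probability of a given trajectory under policy `pol`. -/
noncomputable def trajProb (M : LayeredMDP S A) (pol : S → A → ℝ) (τ : Traj M) : ℝ :=
  (if τ.1 0 = M.s0 then (1 : ℝ) else 0) *
    ∏ k : Fin M.L, pol (τ.1 k.castSucc) (τ.2 k) * M.P (τ.1 k.castSucc) (τ.2 k) (τ.1 k.succ)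

/-- Indicator `𝕀(s)` that the trajectory visits state `s` at its layer. -/
noncomputable def stInd (M : LayeredMDP S A) (τ : Traj M) (s : S) : ℝ :=
  if τ.1 ⟨M.layer s, Nat.lt_succ_of_le (M.layer_le s)⟩ = s then 1 else 0

/-- Indicator `𝕀(s,a)` that the trajectory visits `(s,a)` at the layer of `s`. -/
noncomputable def saInd (M : LayeredMDP S A) (τ : Traj M) (s : S) (a : A) : ℝ :=
  if h : M.layer s < M.L then
    if τ.1 ⟨M.layer s, Nat.lt_succ_of_le (M.layer_le s)⟩ = s ∧ τ.2 ⟨M.layer s, h⟩ = a then 1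
    else 0
  else 0

/-- Occupancy measure `q^{P,π}(s,a) = Pr[(s_k, a_k) = (s,a)]`. -/
noncomputable def occSA (M : LayeredMDP S A) (pol : S → A → ℝ) (s : S) (a : A) : ℝ :=
  ∑ τ : Traj M, trajProb M pol τ * saInd M τ s a

/-- Occupancy measure `q^{P,π}(s) = Pr[s_k = s]`. -/
noncomputable def occS (M : LayeredMDP S A) (pol : S → A → ℝ) (s : S) : ℝ :=
  ∑ τ : Traj M, trajProb M pol τ * stInd M τ s

/-- Aggregate loss `∑_{k=0}^{L-1} ℓ(s_k, a_k)` of a trajectory. -/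
noncomputable def aggLoss (M : LayeredMDP S A) (l : S → A → ℝ) (τ : Traj M) : ℝ :=
  ∑ k : Fin M.L, l (τ.1 k.castSucc) (τ.2 k)

/-- The sum of `h` over all `n`-step paths started at `s`, each path weighted by the product of its
policy and transition probabilities. -/
noncomputable def pathSum (M : LayeredMDP S A) (pol : S → A → ℝ) (n : ℕ)
    (h : (Fin (n + 1) → S) → (Fin n → A) → ℝ) (s : S) : ℝ :=
  ∑ x : Fin (n + 1) → S, ∑ y : Fin n → A, (if x 0 = s then (1 : ℝ) else 0) *
    (∏ k : Fin n, pol (x k.castSucc) (y k) * M.P (x k.castSucc) (y k) (x k.succ)) * h x y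

theorem pathSum_succ (M : LayeredMDP S A) (pol : S → A → ℝ) (n : ℕ)
    (h : (Fin (n + 2) → S) → (Fin (n + 1) → A) → ℝ) (s : S) :
    pathSum M pol (n + 1) h s = ∑ a, pol s a * ∑ s', M.P s a s' *
      pathSum M pol n (fun x y => h (Fin.cons s x) (Fin.cons a y)) s' := by
  have hL : pathSum M pol (n + 1) h s = ∑ x : Fin (n + 1) → S, ∑ a, ∑ y : Fin n → A,
      pol s a * M.P s a (x 0) *
      (∏ k : Fin n, pol (x k.castSucc) (y k) * M.P (x k.castSucc) (y k) (x k.succ)) *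
      h (Fin.cons s x) (Fin.cons a y) := by
    unfold pathSum
    rw [← (Fin.consEquiv fun _ => S).sum_comp, Fintype.sum_prod_type]
    rw [Fintype.sum_eq_single s]
    · refine Finset.sum_congr rfl fun x _ => ?_
      rw [← (Fin.consEquiv fun _ => A).sum_comp, Fintype.sum_prod_type]
      refine Finset.sum_congr rfl fun a _ => Finset.sum_congr rfl fun y _ => ?_
      rw [Fin.prod_univ_succ]
      simp [Fin.consEquiv]
    · intro t ht
      simp [Fin.consEquiv, ht]
  rw [hL, Finset.sum_comm]
  refine Finset.sum_congr rfl fun a _ => ?_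
  symm
  simp only [pathSum, Finset.mul_sum]
  rw [Finset.sum_comm]
  refine Finset.sum_congr rfl fun x _ => ?_
  rw [Finset.sum_comm]
  refine Finset.sum_congr rfl fun y _ => ?_
  rw [Fintype.sum_eq_single (x 0)]
  · simp only [if_true]
    ring
  · intro t ht
    simp [ht.symm]

theorem LayeredMDP.ne_sL_of_layer_lt {M : LayeredMDP S A} {s : S} (h : M.layer s < M.L) :
    s ≠ M.sL := by
  rintro rfl
  exact h.ne M.layer_sL

theorem pathSum_one (M : LayeredMDP S A) {pol : S → A → ℝ} (hpol : IsPolicy M pol) (n : ℕ) (s : S)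
    (hn : M.layer s + n = M.L) : pathSum M pol n (fun _ _ => 1) s = 1 := by
  induction n generalizing s with
  | zero =>
    unfold pathSum
    rw [← (Equiv.funUnique (Fin 1) S).symm.sum_comp]
    simp
  | succ n ih =>
    have hs : M.layer s < M.L := by omega
    rw [pathSum_succ]
    refine Eq.trans ?_ (hpol.2 s (LayeredMDP.ne_sL_of_layer_lt hs))
    refine Finset.sum_congr rfl fun a _ => ?_
    refine Eq.trans (congrArg (pol s a * ·) ?_) (mul_one _)
    refine Eq.trans ?_ (M.P_sum s a hs)
    refine Finset.sum_congr rfl fun s' _ => ?_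
    by_cases hP : M.P s a s' = 0
    · simp [hP]
    · rw [ih s' (by have := M.P_layer s a s' hP; omega), mul_one]

theorem pathSum_stateAction (M : LayeredMDP S A) {pol : S → A → ℝ} (hpol : IsPolicy M pol)
    (s : S) (a : A) (n : ℕ) (k : Fin n) (t : S) (hn : M.layer t + n = M.L) :
    pathSum M pol n (fun x y => if x k.castSucc = s ∧ y k = a then 1 else 0) t =
      pol s a * pathSum M pol n (fun x _ => if x k.castSucc = s then 1 else 0) t := by
  induction n generalizing t with
  | zero => exact k.elim0
  | succ n ih =>
    have ht : M.layer t < M.L := by omega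
    have hnext : ∀ b t', M.P t b t' ≠ 0 → M.layer t' + n = M.L := fun b t' h => by
      have := M.P_layer t b t' h
      omega
    have hone : ∀ b, ∑ t', M.P t b t' * pathSum M pol n (fun _ _ => 1) t' = 1 := fun b => by
      refine Eq.trans ?_ (M.P_sum t b ht)
      refine Finset.sum_congr rfl fun t' _ => ?_
      by_cases hP : M.P t b t' = 0
      · simp [hP]
      · rw [pathSum_one M hpol n t' (hnext b t' hP), mul_one]
    have hzero : ∀ t', pathSum M pol n (fun _ _ => 0) t' = 0 := fun t' => by simp [pathSum]
    rw [pathSum_succ, pathSum_succ]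
    induction k using Fin.cases with
    | zero =>
      by_cases hts : t = s
      · subst hts
        have hb : ∀ b, ∑ t', M.P t b t' * pathSum M pol n
            (fun _ _ => if b = a then (1 : ℝ) else 0) t' = if b = a then 1 else 0 := fun b => by
          split_ifs
          · exact hone b
          · simp [hzero]
        simp [hb, hone, hpol.2 t (LayeredMDP.ne_sL_of_layer_lt ht)]
      · simp [hts, hzero]
    | succ k =>
      simp only [← Fin.succ_castSucc, Fin.cons_succ]
      rw [Finset.mul_sum]
      refine Finset.sum_congr rfl fun b _ => ?_
      rw [mul_left_comm]
      congr 1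
      rw [Finset.mul_sum]
      refine Finset.sum_congr rfl fun t' _ => ?_
      by_cases hP : M.P t b t' = 0
      · simp [hP]
      · rw [ih k t' (hnext b t' hP), mul_left_comm]

theorem sum_trajProb_mul (M : LayeredMDP S A) (pol : S → A → ℝ) (f : Traj M → ℝ) :
    ∑ τ, trajProb M pol τ * f τ = pathSum M pol M.L (fun x y => f (x, y)) M.s0 := by
  rw [Fintype.sum_prod_type]
  rfl

theorem occSA_eq (M : LayeredMDP S A) {pol : S → A → ℝ} (hpol : IsPolicy M pol) {s : S}
    (hs : s ≠ M.sL) (a : A) : occSA M pol s a = pol s a * occS M pol s := by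
  have hlt : M.layer s < M.L := lt_of_le_of_ne (M.layer_le s) fun h => hs (M.sL_unique s h)
  have h := pathSum_stateAction M hpol s a M.L ⟨M.layer s, hlt⟩ M.s0 (by simp [M.layer_s0])
  rw [occSA, occS, sum_trajProb_mul, sum_trajProb_mul]
  simpa [saInd, stInd, hlt] using h

theorem saInd_mem (M : LayeredMDP S A) (τ : Traj M) (s : S) (a : A) :
    (stInd M τ s = 0 ∧ saInd M τ s a = 0) ∨ (stInd M τ s = 1 ∧ saInd M τ s a = 0) ∨
      (stInd M τ s = 1 ∧ saInd M τ s a = 1) := by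
  unfold stInd saInd
  split_ifs <;> simp_all

/-- The law of a function of finitely many values, with integrability. -/
theorem integrable_and_integral_comp_fintype {Ω T : Type*} [MeasurableSpace Ω] [Fintype T]
    (μ : Measure Ω) [IsFiniteMeasure μ] (X : Ω → T) (hX : ∀ t, MeasurableSet {ω | X ω = t})
    (f : T → ℝ) : Integrable (fun ω => f (X ω)) μ ∧
      ∫ ω, f (X ω) ∂μ = ∑ t, (μ {ω | X ω = t}).toReal * f t := by
  classical
  have hf : (fun ω => f (X ω)) = fun ω => ∑ t, {ω | X ω = t}.indicator (fun _ => f t) ω := by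
    funext ω
    simp [Set.indicator_apply]
  have hi : ∀ t ∈ Finset.univ, Integrable ({ω | X ω = t}.indicator fun _ => f t) μ :=
    fun t _ => (integrable_const (f t)).indicator (hX t)
  rw [hf]
  refine ⟨integrable_finsetSum _ hi, ?_⟩
  rw [integral_finsetSum _ hi]
  refine Finset.sum_congr rfl fun t _ => ?_
  rw [integral_indicator_const _ (hX t), smul_eq_mul]
  rfl

theorem estimator_sq_le {p c w I J : ℝ} (hp0 : 0 ≤ p) (hp1 : p ≤ 1) (hc0 : 0 ≤ c) (hc1 : c ≤ 1)
    (hIJ : (I = 0 ∧ J = 0) ∨ (I = 1 ∧ J = 0) ∨ (I = 1 ∧ J = 1)) :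
    ((c * J + (1 - p - c) * I * p) / w - (1 - p)) ^ 2 ≤
      2 * ((1 - p) ^ 2 * (1 + p) ^ 2 * J + p ^ 2 * (I - J)) / w ^ 2 + 2 * (1 - p) ^ 2 := by
  have hN : (c * J + (1 - p - c) * I * p) ^ 2 ≤
      (1 - p) ^ 2 * (1 + p) ^ 2 * J + p ^ 2 * (I - J) := by
    rcases hIJ with ⟨rfl, rfl⟩ | ⟨rfl, rfl⟩ | ⟨rfl, rfl⟩
    · simp
    · have h : (1 - p - c) ^ 2 ≤ 1 := by
        rw [sq_le_one_iff_abs_le_one, abs_le]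
        constructor <;> linarith
      nlinarith [mul_le_mul_of_nonneg_right h (sq_nonneg p)]
    · have h : (c + p) ^ 2 ≤ (1 + p) ^ 2 := by gcongr
      nlinarith [mul_le_mul_of_nonneg_left h (sq_nonneg (1 - p))]
  calc ((c * J + (1 - p - c) * I * p) / w - (1 - p)) ^ 2
      ≤ 2 * ((c * J + (1 - p - c) * I * p) / w) ^ 2 + 2 * (1 - p) ^ 2 := by
        nlinarith [sq_nonneg ((c * J + (1 - p - c) * I * p) / w + (1 - p))]
    _ = 2 * (c * J + (1 - p - c) * I * p) ^ 2 / w ^ 2 + 2 * (1 - p) ^ 2 := by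
        rw [div_pow, mul_div_assoc]
    _ ≤ _ := by gcongr

theorem second_moment_bound {p u q : ℝ} (hp0 : 0 < p) (hp1 : p ≤ 1) (hu : 0 < u) (hup : u * p ≤ 1)
    (hq : 0 ≤ q) :
    2 * ((1 - p) ^ 2 * (1 + p) ^ 2 * (p * q) + p ^ 2 * (q - p * q)) / (u * p) ^ 2
      + 2 * (1 - p) ^ 2 ≤ 8 * ((1 - p) / (u * p)) * (q / u + 1) := by
  have hr : 0 ≤ 1 - p := by linarith
  have hcoef : 2 * ((1 - p) * (1 + p) ^ 2 + p) ≤ 8 := by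
    nlinarith [mul_nonneg hr hp0.le, mul_nonneg (mul_nonneg hr hp0.le) hp0.le]
  have h1 : 2 * ((1 - p) ^ 2 * (1 + p) ^ 2 * (p * q) + p ^ 2 * (q - p * q)) / (u * p) ^ 2
      ≤ 8 * ((1 - p) / (u * p)) * (q / u) := by
    calc _ = 2 * ((1 - p) * (1 + p) ^ 2 + p) * ((1 - p) / (u * p) * (q / u)) := by
          field_simp
      _ ≤ 8 * ((1 - p) / (u * p) * (q / u)) := by gcongr
      _ = _ := by ring
  have h2 : 2 * (1 - p) ^ 2 ≤ 8 * ((1 - p) / (u * p)) := by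
    have h3 : 1 - p ≤ (1 - p) / (u * p) := le_div_self hr (by positivity) hup
    nlinarith [mul_nonneg hr hp0.le]
  linarith

/-- second moment of the optimistic loss estimator `ℓ^u`.
If `0 ≤ c ≤ 1` almost surely, `π(a|s) > 0`, `u_s ≥ q(s)`, `u_s > 0`, and
`u(s,a) = u_s·π(a|s) ≤ 1`, then
`E[(ℓ^u(s,a))²] ≤ 8·((1 − π(a|s))/u(s,a))·(q(s)/u_s + 1)`. -/
theorem stmt5 (M : LayeredMDP S A) (pol : S → A → ℝ) (hpol : IsPolicy M pol)
    {Ω : Type} [MeasurableSpace Ω] (μ : Measure Ω) [IsProbabilityMeasure μ]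
    (traj : Ω → Traj M) (c : Ω → ℝ)
    (hmeas : ∀ τ : Traj M, MeasurableSet {ω | traj ω = τ})
    (hdist : ∀ τ : Traj M, (μ {ω | traj ω = τ}).toReal = trajProb M pol τ)
    (hcmeas : Measurable c)
    (hc01 : ∀ᵐ ω ∂μ, c ω ∈ Set.Icc (0 : ℝ) 1)
    (s : S) (a : A) (hs : s ≠ M.sL) (hpa : 0 < pol s a)
    (us : ℝ) (hus0 : 0 < us) (hus : occS M pol s ≤ us)
    (hu1 : us * pol s a ≤ 1) :
    ∫ ω, ((c ω * saInd M (traj ω) s a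
          + (1 - pol s a - c ω) * stInd M (traj ω) s * pol s a) / (us * pol s a)
        - (1 - pol s a)) ^ 2 ∂μ
      ≤ 8 * ((1 - pol s a) / (us * pol s a)) * (occS M pol s / us + 1) := by
  have hp1 : pol s a ≤ 1 := by
    rw [← hpol.2 s hs]
    exact Finset.single_le_sum (fun b _ => hpol.1 s b) (Finset.mem_univ a)
  have hq : 0 ≤ occS M pol s := Finset.sum_nonneg fun τ _ => by
    rw [← hdist τ]
    unfold stInd
    split_ifs <;> simp
  obtain ⟨hIi, hI⟩ := integrable_and_integral_comp_fintype μ traj hmeas fun τ => stInd M τ s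
  obtain ⟨hJi, hJ⟩ := integrable_and_integral_comp_fintype μ traj hmeas fun τ => saInd M τ s a
  simp only [hdist] at hI hJ
  change _ = occS M pol s at hI
  change _ = occSA M pol s a at hJ
  rw [occSA_eq M hpol hs] at hJ
  set p := pol s a
  set w := us * p
  have hgi : Integrable (fun ω => (1 - p) ^ 2 * (1 + p) ^ 2 * saInd M (traj ω) s a
      + p ^ 2 * (stInd M (traj ω) s - saInd M (traj ω) s a)) μ :=
    (hJi.const_mul _).add ((hIi.sub hJi).const_mul _)
  have hgi' := (hgi.const_mul 2).div_const (w ^ 2)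
  calc _ ≤ ∫ ω, (2 * ((1 - p) ^ 2 * (1 + p) ^ 2 * saInd M (traj ω) s a
        + p ^ 2 * (stInd M (traj ω) s - saInd M (traj ω) s a)) / w ^ 2 + 2 * (1 - p) ^ 2) ∂μ := by
        refine integral_mono_of_nonneg (Filter.Eventually.of_forall fun ω => sq_nonneg _)
          (hgi'.add (integrable_const _)) ?_
        filter_upwards [hc01] with ω hc
        exact estimator_sq_le hpa.le hp1 hc.1 hc.2 (saInd_mem M (traj ω) s a)
    _ = 2 * ((1 - p) ^ 2 * (1 + p) ^ 2 * (p * occS M pol s)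
        + p ^ 2 * (occS M pol s - p * occS M pol s)) / w ^ 2 + 2 * (1 - p) ^ 2 := by
        rw [integral_add hgi' (integrable_const _), integral_div, integral_const_mul,
          integral_add (hJi.const_mul _) ((hIi.sub' hJi).const_mul _), integral_const_mul,
          integral_const_mul, integral_sub hIi hJi, hI, hJ]
        simp
    _ ≤ _ := second_moment_bound hpa hp1 hus0 hu1 hq
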